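/- For every δ ∈ (0,1), with probability at least 1 − δ over a sample (x_1,…,x_n) drawn i.i.d. from ν (i.e., from ν^{⊗n}), the following holds: for every ĝ ∈ G with R̂̃(ĝ) ≤ R̂̃(g) for all g ∈ G (an empirical risk minimizer) and every g̃* ∈ G, R̃(ĝ) − R̃(g̃*) ≤ (4√2 · L_ℓ / C_r) · ∑_{y : Fin K} Rad_n(G_y, ν) + (2 C_ℓ / C_r) · √(log(2/δ) / (2n)). (Lemma 1 of the paper: excess surrogate risk bound for noise-robust SC-Conf classification.) -/

import Mathlib

open MeasureTheory

/-- Expected Rademacher complexity of a class `F` of real-valued functions on a sample of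
size `n` drawn i.i.d. from `ρ`. -/
noncomputable def rademacherComplexity {X : Type*} [MeasurableSpace X] (ρ : Measure X)
    (n : ℕ) (F : Set (X → ℝ)) : ℝ :=
  ∫ xs : Fin n → X,
    (∑ σ : Fin n → Bool,
        sSup ((fun f : X → ℝ => (∑ i, (if σ i then (1 : ℝ) else -1) * f (xs i)) / n) '' F))
      / 2 ^ n
    ∂(Measure.pi fun _ => ρ)

section SignAverages

open scoped BigOperators

/-- The real sign `±1` encoded by a Boolean. -/
def boolSign (b : Bool) : ℝ := if b then 1 else -1

@[simp] lemma boolSign_true : boolSign true = 1 := rfl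

@[simp] lemma boolSign_false : boolSign false = -1 := rfl

@[simp] lemma boolSign_not (b : Bool) : boolSign (!b) = -boolSign b := by cases b <;> simp

lemma abs_boolSign (b : Bool) : |boolSign b| = 1 := by cases b <;> simp

lemma expect_bool (g : Bool → ℝ) : 𝔼 b, g b = (g true + g false) / 2 := by
  rw [Fintype.expect_eq_sum_div_card]
  simp

lemma expect_fin_succ {α : Type*} [Fintype α] {n : ℕ} (F : (Fin (n + 1) → α) → ℝ) :
    𝔼 x, F x = 𝔼 a, 𝔼 x, F (Fin.cons a x) := by
  rw [← Fintype.expect_equiv (Fin.consEquiv fun _ => α) (fun p => F (Fin.cons p.1 p.2)) F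
    fun _ => rfl]
  exact Finset.expect_product' _ _ fun a x => F (Fin.cons a x)

lemma expect_bool_cube_succ {n : ℕ} (F : (Fin (n + 1) → Bool) → ℝ) :
    𝔼 x, F x = 𝔼 x, (F (Fin.cons true x) + F (Fin.cons false x)) / 2 := by
  rw [expect_fin_succ, expect_bool, ← Finset.expect_add_distrib, Finset.expect_div]

lemma expect_not (n : ℕ) (F : (Fin n → Bool) → ℝ) :
    𝔼 σ : Fin n → Bool, F (fun i => !σ i) = 𝔼 σ, F σ :=
  Fintype.expect_equiv (Equiv.piCongrRight fun _ => Equiv.boolNot) _ _ fun _ => rfl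

/-- The Dirichlet form of the simple random walk on the discrete cube. -/
noncomputable def cubeDirichlet {n : ℕ} (f : (Fin n → Bool) → ℝ) : ℝ :=
  𝔼 σ, ∑ i, ((f σ - f (Function.update σ i (!σ i))) / 2) ^ 2

lemma cubeDirichlet_nonneg {n : ℕ} (f : (Fin n → Bool) → ℝ) : 0 ≤ cubeDirichlet f :=
  Finset.expect_nonneg fun _ _ => Finset.sum_nonneg fun _ _ => sq_nonneg _

lemma cubeDirichlet_succ {n : ℕ} (f : (Fin (n + 1) → Bool) → ℝ) :
    cubeDirichlet f =
      𝔼 σ, ((f (Fin.cons true σ) - f (Fin.cons false σ)) / 2) ^ 2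
        + cubeDirichlet (fun σ => (f (Fin.cons true σ) + f (Fin.cons false σ)) / 2)
        + cubeDirichlet (fun σ => (f (Fin.cons true σ) - f (Fin.cons false σ)) / 2) := by
  unfold cubeDirichlet
  rw [expect_bool_cube_succ, ← Finset.expect_add_distrib, ← Finset.expect_add_distrib]
  refine Finset.expect_congr rfl fun σ _ => ?_
  simp only [Fin.sum_univ_succ, Fin.cons_zero, Fin.cons_succ, Fin.update_cons_zero,
    ← Fin.cons_update, Bool.not_true, Bool.not_false]
  rw [add_add_add_comm, add_div, add_assoc, ← Finset.sum_add_distrib, ← Finset.sum_add_distrib,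
    Finset.sum_div]
  congr 1
  · ring
  · exact Finset.sum_congr rfl fun i _ => by ring

lemma expect_sq_cube_succ {n : ℕ} (f : (Fin (n + 1) → Bool) → ℝ) :
    𝔼 σ, f σ ^ 2 = 𝔼 σ, ((f (Fin.cons true σ) + f (Fin.cons false σ)) / 2) ^ 2
      + 𝔼 σ, ((f (Fin.cons true σ) - f (Fin.cons false σ)) / 2) ^ 2 := by
  rw [expect_bool_cube_succ, ← Finset.expect_add_distrib]
  exact Finset.expect_congr rfl fun σ _ => by ring

/-- Poincaré inequality on the discrete cube. -/
lemma cube_poincare {n : ℕ} (f : (Fin n → Bool) → ℝ) :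
    𝔼 σ, f σ ^ 2 - (𝔼 σ, f σ) ^ 2 ≤ cubeDirichlet f := by
  induction n with
  | zero =>
    refine le_trans (le_of_eq ?_) (cubeDirichlet_nonneg f)
    simp
  | succ n ih =>
    rw [cubeDirichlet_succ, expect_sq_cube_succ, expect_bool_cube_succ f]
    have h := ih fun σ => (f (Fin.cons true σ) + f (Fin.cons false σ)) / 2
    have := cubeDirichlet_nonneg fun σ => (f (Fin.cons true σ) - f (Fin.cons false σ)) / 2
    linarith

/-- Poincaré inequality on the discrete cube with the optimal constant `2` away from the
first-order Walsh coefficients. -/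
lemma cube_poincare_first_order {n : ℕ} (f : (Fin n → Bool) → ℝ) :
    2 * (𝔼 σ, f σ ^ 2 - (𝔼 σ, f σ) ^ 2) ≤
      cubeDirichlet f + ∑ i, (𝔼 σ, boolSign (σ i) * f σ) ^ 2 := by
  induction n with
  | zero =>
    refine le_trans (le_of_eq ?_) (add_nonneg (cubeDirichlet_nonneg f)
      (Finset.sum_nonneg fun _ _ => sq_nonneg _))
    simp
  | succ n ih =>
    have ha := ih fun σ => (f (Fin.cons true σ) + f (Fin.cons false σ)) / 2
    have hb := cube_poincare fun σ => (f (Fin.cons true σ) - f (Fin.cons false σ)) / 2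
    have h0 : 𝔼 σ : Fin (n + 1) → Bool, boolSign (σ 0) * f σ
        = 𝔼 σ, (f (Fin.cons true σ) - f (Fin.cons false σ)) / 2 := by
      rw [expect_bool_cube_succ]
      exact Finset.expect_congr rfl fun σ _ => by simp; ring
    have hs (i : Fin n) : 𝔼 σ : Fin (n + 1) → Bool, boolSign (σ i.succ) * f σ
        = 𝔼 σ, boolSign (σ i) * ((f (Fin.cons true σ) + f (Fin.cons false σ)) / 2) := by
      rw [expect_bool_cube_succ]
      exact Finset.expect_congr rfl fun σ _ => by simp; ring
    rw [cubeDirichlet_succ, expect_sq_cube_succ, expect_bool_cube_succ f, Fin.sum_univ_succ, h0]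
    simp only [hs]
    linarith

lemma expect_sq_sum_boolSign {n : ℕ} (v : Fin n → ℝ) :
    𝔼 σ : Fin n → Bool, (∑ i, boolSign (σ i) * v i) ^ 2 = ∑ i, v i ^ 2 := by
  induction n with
  | zero => simp
  | succ n ih =>
    rw [expect_bool_cube_succ, Fin.sum_univ_succ, ← ih,
      ← Fintype.expect_const (ι := Fin n → Bool) (v 0 ^ 2), ← Finset.expect_add_distrib]
    refine Finset.expect_congr rfl fun σ _ => ?_
    simp only [Fin.sum_univ_succ, Fin.cons_zero, Fin.cons_succ, boolSign_true, boolSign_false]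
    ring

/-- Khintchine's inequality in `L¹` with the sharp constant `√2`. -/
lemma khintchine_sqrt_two {n : ℕ} (v : Fin n → ℝ) :
    √(∑ i, v i ^ 2) ≤ √2 * 𝔼 σ : Fin n → Bool, |∑ i, boolSign (σ i) * v i| := by
  set f : (Fin n → Bool) → ℝ := fun σ => |∑ i, boolSign (σ i) * v i| with hf
  have hsq : 𝔼 σ, f σ ^ 2 = ∑ i, v i ^ 2 := by
    simp only [hf, sq_abs, expect_sq_sum_boolSign]
  have hD : cubeDirichlet f ≤ ∑ i, v i ^ 2 := by
    rw [← Fintype.expect_const (ι := Fin n → Bool) (∑ i, v i ^ 2)]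
    refine Finset.expect_le_expect fun σ _ => Finset.sum_le_sum fun i _ => ?_
    have hdiff : ∑ j, boolSign (σ j) * v j
        - ∑ j, boolSign (Function.update σ i (!σ i) j) * v j = 2 * (boolSign (σ i) * v i) := by
      rw [← Finset.sum_sub_distrib, Finset.sum_eq_single i]
      · simp; ring
      · intro j _ hj; simp [Function.update_of_ne hj]
      · simp
    have h := abs_abs_sub_abs_le (∑ j, boolSign (σ j) * v j)
      (∑ j, boolSign (Function.update σ i (!σ i) j) * v j)
    rw [hdiff, abs_mul, abs_mul, abs_boolSign, one_mul, abs_two] at h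
    rw [sq_le_sq, abs_div, abs_two]
    linarith
  have h1 (i : Fin n) : 𝔼 σ, boolSign (σ i) * f σ = 0 := by
    have h := expect_not n fun σ => boolSign (σ i) * f σ
    have h' (σ : Fin n → Bool) : boolSign (!σ i) * f (fun i => !σ i)
        = -(boolSign (σ i) * f σ) := by
      simp [hf, Finset.sum_neg_distrib]
    simp only [h', Finset.expect_neg_distrib] at h
    linarith
  have hP := cube_poincare_first_order f
  simp only [h1, hsq] at hP
  have hE : 0 ≤ 𝔼 σ, f σ := Finset.expect_nonneg fun _ _ => abs_nonneg _
  refine Real.sqrt_le_iff.2 ⟨by positivity, ?_⟩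
  rw [mul_pow, Real.sq_sqrt zero_le_two]
  simp at hP
  linarith

end SignAverages

section VectorContraction

open scoped BigOperators

/-- A real-valued function with bounded range. -/
def IsBddFun {T : Type*} (f : T → ℝ) : Prop := ∃ C, ∀ t, |f t| ≤ C

namespace IsBddFun

variable {T : Type*} {f g : T → ℝ}

lemma zero : IsBddFun fun _ : T => (0 : ℝ) := ⟨0, fun _ => by simp⟩

lemma add (hf : IsBddFun f) (hg : IsBddFun g) : IsBddFun fun t => f t + g t := by
  obtain ⟨C, hC⟩ := hf
  obtain ⟨D, hD⟩ := hg
  exact ⟨C + D, fun t => (abs_add_le _ _).trans (add_le_add (hC t) (hD t))⟩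

lemma const_mul (c : ℝ) (hf : IsBddFun f) : IsBddFun fun t => c * f t := by
  obtain ⟨C, hC⟩ := hf
  exact ⟨|c| * C, fun t => by
    rw [abs_mul]; exact mul_le_mul_of_nonneg_left (hC t) (abs_nonneg c)⟩

lemma sub (hf : IsBddFun f) (hg : IsBddFun g) : IsBddFun fun t => f t - g t := by
  simpa [sub_eq_add_neg] using hf.add (hg.const_mul (-1))

lemma comp (hf : IsBddFun f) {S : Type*} (p : S → T) : IsBddFun fun s => f (p s) := by
  obtain ⟨C, hC⟩ := hf
  exact ⟨C, fun s => hC (p s)⟩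

lemma exp (hf : IsBddFun f) : IsBddFun fun t => Real.exp (f t) := by
  obtain ⟨C, hC⟩ := hf
  exact ⟨Real.exp C, fun t => by
    rw [Real.abs_exp]; exact Real.exp_le_exp.2 ((le_abs_self _).trans (hC t))⟩

lemma sum {ι : Type*} (s : Finset ι) {F : ι → T → ℝ} (hF : ∀ i, IsBddFun (F i)) :
    IsBddFun fun t => ∑ i ∈ s, F i t := by
  choose C hC using hF
  exact ⟨∑ i ∈ s, C i, fun t => (Finset.abs_sum_le_sum_abs _ _).trans
    (Finset.sum_le_sum fun i _ => hC i t)⟩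

lemma bddAbove (hf : IsBddFun f) : BddAbove (Set.range f) := by
  obtain ⟨C, hC⟩ := hf
  exact ⟨C, by rintro _ ⟨t, rfl⟩; exact (le_abs_self _).trans (hC t)⟩

lemma le_ciSup (hf : IsBddFun f) (t : T) : f t ≤ ⨆ t, f t :=
  _root_.le_ciSup hf.bddAbove t

end IsBddFun

variable {T : Type*} [Nonempty T] {K n : ℕ}

/-- A single Rademacher sign in front of a Lipschitz function of a vector may be replaced by
independent signs in front of the coordinates of that vector. -/
lemma expect_ciSup_boolSign_le {A ψ : T → ℝ} {v : T → Fin K → ℝ} {L : ℝ} (hL : 0 ≤ L)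
    (hA : IsBddFun A) (hv : ∀ k, IsBddFun fun t => v t k)
    (hψ : ∀ t t', |ψ t - ψ t'| ≤ L * √(∑ k, (v t k - v t' k) ^ 2)) :
    𝔼 s, ⨆ t, (A t + boolSign s * ψ t) ≤
      𝔼 ε : Fin K → Bool, ⨆ t, (A t + √2 * L * ∑ k, boolSign (ε k) * v t k) := by
  set S : (Fin K → Bool) → ℝ := fun ε => ⨆ t, (A t + √2 * L * ∑ k, boolSign (ε k) * v t k)
    with hS
  have hle (ε : Fin K → Bool) (t : T) :
      A t + √2 * L * ∑ k, boolSign (ε k) * v t k ≤ S ε :=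
    (hA.add ((IsBddFun.sum _ fun k => (hv k).const_mul _).const_mul _)).le_ciSup t
  have hpair (t t' : T) : (A t + ψ t) + (A t' - ψ t') ≤ 2 * 𝔼 ε, S ε := by
    have hψ' : ψ t - ψ t' ≤
        𝔼 ε : Fin K → Bool, √2 * L * |∑ k, boolSign (ε k) * (v t k - v t' k)| := by
      rw [← Finset.mul_expect]
      calc ψ t - ψ t' ≤ L * √(∑ k, (v t k - v t' k) ^ 2) := (le_abs_self _).trans (hψ t t')
        _ ≤ L * (√2 * _) := mul_le_mul_of_nonneg_left (khintchine_sqrt_two _) hL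
        _ = _ := by ring
    have hsign : 𝔼 ε : Fin K → Bool, (A t + A t' + √2 * L * |∑ k, boolSign (ε k) * (v t k - v t' k)|) ≤
        𝔼 ε : Fin K → Bool, (S ε + S fun k => !ε k) := by
      refine Finset.expect_le_expect fun ε _ => ?_
      have h1 := hle ε t
      have h2 := hle ε t'
      have h3 := hle (fun k => !ε k) t
      have h4 := hle (fun k => !ε k) t'
      simp only [boolSign_not, neg_mul, Finset.sum_neg_distrib, mul_neg] at h3 h4
      simp only [mul_sub, Finset.sum_sub_distrib]
      rcases abs_cases (∑ k, boolSign (ε k) * v t k - ∑ k, boolSign (ε k) * v t' k) with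
        ⟨h, _⟩ | ⟨h, _⟩ <;> rw [h] <;> linarith
    rw [Finset.expect_add_distrib, Finset.expect_add_distrib (f := S), expect_not K S,
      Fintype.expect_const] at hsign
    linarith
  rw [expect_bool]
  have := ciSup_add_ciSup_le hpair
  simp only [boolSign_true, boolSign_false, one_mul, neg_mul, ← sub_eq_add_neg]
  linarith

lemma expect_ciSup_add_boolSign_le {A : T → ℝ} {ψ : Fin n → T → ℝ} {v : Fin n → T → Fin K → ℝ}
    {L : ℝ} (hL : 0 ≤ L) (hA : IsBddFun A) (hψb : ∀ i, IsBddFun (ψ i))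
    (hv : ∀ i k, IsBddFun fun t => v i t k)
    (hψ : ∀ i t t', |ψ i t - ψ i t'| ≤ L * √(∑ k, (v i t k - v i t' k) ^ 2)) :
    𝔼 σ : Fin n → Bool, ⨆ t, (A t + ∑ i, boolSign (σ i) * ψ i t) ≤
      𝔼 ε : Fin n → Fin K → Bool,
        ⨆ t, (A t + √2 * L * ∑ i, ∑ k, boolSign (ε i k) * v i t k) := by
  induction n generalizing A with
  | zero => simp
  | succ n ih =>
    calc 𝔼 σ : Fin (n + 1) → Bool, ⨆ t, (A t + ∑ i, boolSign (σ i) * ψ i t)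
        = 𝔼 σ : Fin n → Bool, 𝔼 s, ⨆ t,
            ((A t + ∑ i : Fin n, boolSign (σ i) * ψ i.succ t) + boolSign s * ψ 0 t) := by
          rw [expect_fin_succ, Finset.expect_comm]
          simp only [Fin.sum_univ_succ, Fin.cons_zero, Fin.cons_succ]
          simp only [add_comm, add_left_comm]
      _ ≤ 𝔼 σ : Fin n → Bool, 𝔼 ε : Fin K → Bool, ⨆ t,
            ((A t + ∑ i : Fin n, boolSign (σ i) * ψ i.succ t)
              + √2 * L * ∑ k, boolSign (ε k) * v 0 t k) :=
          Finset.expect_le_expect fun σ _ => expect_ciSup_boolSign_le hL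
            (hA.add (IsBddFun.sum _ fun i => (hψb i.succ).const_mul _)) (hv 0) (hψ 0)
      _ = 𝔼 ε : Fin K → Bool, 𝔼 σ : Fin n → Bool, ⨆ t,
            ((A t + √2 * L * ∑ k, boolSign (ε k) * v 0 t k)
              + ∑ i : Fin n, boolSign (σ i) * ψ i.succ t) := by
          rw [Finset.expect_comm]
          simp only [add_right_comm]
      _ ≤ 𝔼 ε : Fin K → Bool, 𝔼 ε' : Fin n → Fin K → Bool, ⨆ t,
            ((A t + √2 * L * ∑ k, boolSign (ε k) * v 0 t k)
              + √2 * L * ∑ i : Fin n, ∑ k, boolSign (ε' i k) * v i.succ t k) :=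
          Finset.expect_le_expect fun ε _ => ih
            (hA.add ((IsBddFun.sum _ fun k => (hv 0 k).const_mul _).const_mul _))
            (fun i => hψb i.succ) (fun i => hv i.succ) (fun i => hψ i.succ)
      _ = _ := by
          rw [expect_fin_succ]
          simp only [Fin.sum_univ_succ, Fin.cons_zero, Fin.cons_succ, mul_add, add_assoc]

lemma expect_column (k : Fin K) (F : (Fin n → Bool) → ℝ) :
    𝔼 ε : Fin n → Fin K → Bool, F (fun i => ε i k) = 𝔼 σ, F σ := by
  rw [Fintype.expect_equiv
    ((Equiv.piComm fun (_ : Fin n) (_ : Fin K) => Bool).trans (Equiv.funSplitAt k (Fin n → Bool)))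
    (fun ε => F fun i => ε i k) (fun p => F p.1) fun _ => rfl]
  refine (Finset.expect_product' Finset.univ Finset.univ fun σ _ => F σ).trans ?_
  simp only [Fintype.expect_const]

/-- Vector contraction inequality for empirical Rademacher averages (Maurer). -/
theorem rademacher_vector_contraction {ψ : Fin n → T → ℝ} {v : Fin n → T → Fin K → ℝ}
    {L : ℝ} (hL : 0 ≤ L) (hψb : ∀ i, IsBddFun (ψ i)) (hv : ∀ i k, IsBddFun fun t => v i t k)
    (hψ : ∀ i t t', |ψ i t - ψ i t'| ≤ L * √(∑ k, (v i t k - v i t' k) ^ 2)) :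
    𝔼 σ : Fin n → Bool, ⨆ t, ∑ i, boolSign (σ i) * ψ i t ≤
      √2 * L * ∑ k, 𝔼 σ : Fin n → Bool, ⨆ t, ∑ i, boolSign (σ i) * v i t k := by
  have h := expect_ciSup_add_boolSign_le hL IsBddFun.zero hψb hv hψ
  simp only [zero_add] at h
  refine h.trans ?_
  rw [Finset.mul_sum]
  calc _ ≤ 𝔼 ε : Fin n → Fin K → Bool,
        ∑ k, √2 * L * ⨆ t, ∑ i, boolSign (ε i k) * v i t k := by
        refine Finset.expect_le_expect fun ε _ => ciSup_le fun t => ?_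
        rw [Finset.sum_comm, Finset.mul_sum]
        exact Finset.sum_le_sum fun k _ => mul_le_mul_of_nonneg_left
          ((IsBddFun.sum _ fun i => (hv i k).const_mul (boolSign (ε i k))).le_ciSup t)
          (by positivity)
    _ = _ := by
        rw [Finset.expect_sum_comm]
        refine Finset.sum_congr rfl fun k _ => ?_
        rw [← Finset.mul_expect,
          expect_column k fun σ => ⨆ t, ∑ i, boolSign (σ i) * v i t k]

end VectorContraction

section BoundedDifferences

open MeasureTheory ProbabilityTheory
open scoped BigOperators NNReal

variable {X Y T : Type*} [MeasurableSpace X] [MeasurableSpace Y]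

lemma IsBddFun.integrable {μ : Measure Y} [IsFiniteMeasure μ] {f : Y → ℝ} (hb : IsBddFun f)
    (hf : Measurable f) : Integrable f μ := by
  obtain ⟨C, hC⟩ := hb
  exact Integrable.of_bound hf.aestronglyMeasurable C (Filter.Eventually.of_forall hC)

lemma IsBddFun.integral {μ : Measure Y} [IsProbabilityMeasure μ] {f : T → Y → ℝ}
    (hb : IsBddFun fun p : T × Y => f p.1 p.2) : IsBddFun fun t => ∫ y, f t y ∂μ := by
  obtain ⟨C, hC⟩ := hb
  refine ⟨C, fun t => ?_⟩
  have := norm_integral_le_of_norm_le_const (μ := μ) (f := f t)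
    (Filter.Eventually.of_forall fun y => hC (t, y))
  simpa using this

omit [MeasurableSpace Y] in
lemma IsBddFun.ciSup [Nonempty T] {f : T → Y → ℝ} (hb : IsBddFun fun p : T × Y => f p.1 p.2) :
    IsBddFun fun y => ⨆ t, f t y := by
  obtain ⟨C, hC⟩ := hb
  refine ⟨C, fun y => abs_le.2 ⟨?_, ciSup_le fun t => (abs_le.1 (hC (t, y))).2⟩⟩
  let t₀ : T := Classical.arbitrary T
  exact (abs_le.1 (hC (t₀, y))).1.trans
    (_root_.le_ciSup (f := fun t => f t y) ⟨C, by rintro _ ⟨t, rfl⟩; exact (abs_le.1 (hC (t, y))).2⟩ t₀)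

lemma measurable_fin_cons (n : ℕ) :
    Measurable fun p : X × (Fin n → X) => (Fin.cons p.1 p.2 : Fin (n + 1) → X) := by
  refine measurable_pi_iff.2 fun i => ?_
  refine Fin.cases ?_ (fun j => ?_) i
  · simpa using measurable_fst
  · simpa [Function.comp_def] using (measurable_pi_apply j).comp measurable_snd

lemma integral_pi_fin_succ (ν : Measure X) [IsProbabilityMeasure ν] {n : ℕ}
    {F : (Fin (n + 1) → X) → ℝ} (hF : Measurable F) (hb : IsBddFun F) :
    ∫ x, F x ∂(Measure.pi fun _ => ν) =
      ∫ a, ∫ x, F (Fin.cons a x) ∂(Measure.pi fun _ : Fin n => ν) ∂ν := by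
  rw [← ((measurePreserving_piFinSuccAbove (fun _ : Fin (n + 1) => ν) 0).symm).integral_comp' F]
  simp only [MeasurableEquiv.piFinSuccAbove_symm_apply, Fin.insertNthEquiv_zero]
  exact integral_prod (μ := ν) (ν := Measure.pi fun _ : Fin n => ν)
    (fun p : X × (Fin n → X) => F (Fin.cons p.1 p.2))
    ((hb.comp _).integrable (hF.comp (measurable_fin_cons n)))

lemma integral_exp_mul_sub_integral_le (ν : Measure X) [IsProbabilityMeasure ν] {c : ℝ}
    {f : X → ℝ} (hf : Measurable f) (hb : IsBddFun f) (hd : ∀ x y, |f x - f y| ≤ c) (s : ℝ) :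
    ∫ x, Real.exp (s * (f x - ∫ y, f y ∂ν)) ∂ν ≤ Real.exp (c ^ 2 * s ^ 2 / 8) := by
  have hbelow : BddBelow (Set.range f) := by
    obtain ⟨C, hC⟩ := hb
    exact ⟨-C, by rintro _ ⟨t, rfl⟩; exact (abs_le.1 (hC t)).1⟩
  have hIcc (x : X) : f x ∈ Set.Icc (⨅ y, f y) ((⨅ y, f y) + c) := by
    have : Nonempty X := ⟨x⟩
    refine ⟨ciInf_le hbelow x, ?_⟩
    have : f x - c ≤ ⨅ y, f y := le_ciInf fun y => by linarith [(abs_le.1 (hd x y)).2]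
    linarith
  have h := (hasSubgaussianMGF_of_mem_Icc (μ := ν) hf.aemeasurable
    (Filter.Eventually.of_forall hIcc)).mgf_le s
  refine h.trans (Real.exp_le_exp.2 (le_of_eq ?_))
  simp only [add_sub_cancel_left, NNReal.coe_pow, NNReal.coe_div, coe_nnnorm, Real.norm_eq_abs,
    NNReal.coe_ofNat, div_pow, sq_abs]
  ring

lemma integral_exp_bounded_differences_le (ν : Measure X) [IsProbabilityMeasure ν] {c : ℝ}
    {n : ℕ} {F : (Fin n → X) → ℝ} (hF : Measurable F) (hb : IsBddFun F)
    (hd : ∀ x i y, |F (Function.update x i y) - F x| ≤ c) (s : ℝ) :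
    ∫ x, Real.exp (s * (F x - ∫ y, F y ∂(Measure.pi fun _ => ν))) ∂(Measure.pi fun _ => ν) ≤
      Real.exp (n * c ^ 2 * s ^ 2 / 8) := by
  induction n with
  | zero =>
    have h (x : Fin 0 → X) : F x = F default := congrArg F (Subsingleton.elim _ _)
    simp [h]
  | succ n ih =>
    set m : X → ℝ := fun a => ∫ x, F (Fin.cons a x) ∂(Measure.pi fun _ : Fin n => ν) with hm
    have hFc : Measurable fun p : X × (Fin n → X) => F (Fin.cons p.1 p.2) :=
      hF.comp (measurable_fin_cons n)
    have hFa (a : X) : Measurable fun x : Fin n → X => F (Fin.cons a x) :=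
      hFc.comp measurable_prodMk_left
    have hbc : IsBddFun fun p : X × (Fin n → X) => F (Fin.cons p.1 p.2) := hb.comp _
    have hmm : Measurable m := hFc.stronglyMeasurable.integral_prod_right.measurable
    have hmb : IsBddFun m := hbc.integral
    have hint : ∫ x, F x ∂(Measure.pi fun _ => ν) = ∫ a, m a ∂ν := integral_pi_fin_succ ν hF hb
    have hmd (a b : X) : |m a - m b| ≤ c := by
      have h : m a - m b =
          ∫ x, (F (Fin.cons a x) - F (Fin.cons b x)) ∂(Measure.pi fun _ : Fin n => ν) :=
        (integral_sub ((hb.comp _).integrable (hFa a)) ((hb.comp _).integrable (hFa b))).symm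
      rw [h]
      have := norm_integral_le_of_norm_le_const (μ := Measure.pi fun _ : Fin n => ν)
        (f := fun x => F (Fin.cons a x) - F (Fin.cons b x)) (C := c)
        (Filter.Eventually.of_forall fun x => by
          simpa [Fin.update_cons_zero] using hd (Fin.cons b x) 0 a)
      simpa using this
    have hcond (a : X) : ∫ x, Real.exp (s * (F (Fin.cons a x) - ∫ b, m b ∂ν))
          ∂(Measure.pi fun _ : Fin n => ν) ≤
        Real.exp (s * (m a - ∫ b, m b ∂ν)) * Real.exp (n * c ^ 2 * s ^ 2 / 8) := by
      have := ih (hFa a) (hb.comp _) fun x i y => by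
        rw [Fin.cons_update]; exact hd _ _ _
      refine le_trans (le_of_eq ?_) (mul_le_mul_of_nonneg_left this (Real.exp_pos _).le)
      rw [← integral_const_mul]
      refine integral_congr_ae (Filter.Eventually.of_forall fun x => ?_)
      simp only [hm]
      rw [← Real.exp_add]
      congr 1
      ring
    have hbe (k : ℝ) : IsBddFun fun x : Fin (n + 1) → X => Real.exp (s * (F x - k)) :=
      ((hb.sub ⟨|k|, fun _ => le_rfl⟩).const_mul s).exp
    rw [hint, integral_pi_fin_succ ν ((hF.sub_const _).const_mul s).exp (hbe _)]
    calc _ ≤ ∫ a, Real.exp (s * (m a - ∫ b, m b ∂ν)) * Real.exp (n * c ^ 2 * s ^ 2 / 8) ∂ν := by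
          refine integral_mono ?_ ?_ hcond
          · refine IsBddFun.integrable (IsBddFun.integral (((hbe _).comp _))) ?_
            exact ((hFc.sub_const _).const_mul s).exp.stronglyMeasurable.integral_prod_right.measurable
          · exact (((hmb.sub ⟨|_|, fun _ => le_rfl⟩).const_mul s).exp.integrable
              ((hmm.sub_const _).const_mul s).exp).mul_const _
      _ ≤ Real.exp (c ^ 2 * s ^ 2 / 8) * Real.exp (n * c ^ 2 * s ^ 2 / 8) := by
          rw [integral_mul_const]
          exact mul_le_mul_of_nonneg_right (integral_exp_mul_sub_integral_le ν hmm hmb hmd s)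
            (Real.exp_pos _).le
      _ = _ := by
          rw [← Real.exp_add]
          push_cast
          congr 1
          ring

/-- McDiarmid's bounded differences inequality, as a sub-Gaussian moment bound. -/
theorem hasSubgaussianMGF_of_bounded_differences (ν : Measure X) [IsProbabilityMeasure ν]
    {c : ℝ≥0} {n : ℕ} {F : (Fin n → X) → ℝ} (hF : Measurable F) (hb : IsBddFun F)
    (hd : ∀ x i y, |F (Function.update x i y) - F x| ≤ c) :
    HasSubgaussianMGF (fun x => F x - ∫ y, F y ∂(Measure.pi fun _ => ν)) (n * (c / 2) ^ 2)
      (Measure.pi fun _ => ν) where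
  integrable_exp_mul s := ((hb.sub ⟨|_|, fun _ => le_rfl⟩).const_mul s).exp.integrable
    ((hF.sub_const _).const_mul s).exp
  mgf_le s := by
    refine (integral_exp_bounded_differences_le ν hF hb hd s).trans
      (Real.exp_le_exp.2 (le_of_eq ?_))
    push_cast
    ring

end BoundedDifferences

section Symmetrization

open MeasureTheory ProbabilityTheory
open scoped BigOperators NNReal

variable {X T : Type*} [MeasurableSpace X] [Countable T] [Nonempty T] {n : ℕ}

/-- The sum over the sample of the supremum of the deviations from the mean is, in expectation,
at most twice the Rademacher average. -/
theorem integral_ciSup_deviation_le (ν : Measure X) [IsProbabilityMeasure ν] {h : T → X → ℝ}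
    (hm : ∀ t, Measurable (h t)) (hb : IsBddFun fun p : T × X => h p.1 p.2) :
    ∫ x : Fin n → X, ⨆ t, ∑ i, (∫ y, h t y ∂ν - h t (x i)) ∂(Measure.pi fun _ => ν) ≤
      2 * ∫ x : Fin n → X, 𝔼 σ : Fin n → Bool, ⨆ t, ∑ i, boolSign (σ i) * h t (x i)
        ∂(Measure.pi fun _ => ν) := by
  set P : Measure (Fin n → X) := Measure.pi fun _ => ν with hP
  set Q : Measure (Fin n → X × X) := Measure.pi fun _ => ν.prod ν with hQ
  have hmi (t : T) (i : Fin n) : Measurable fun x : Fin n → X => h t (x i) :=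
    (hm t).comp (measurable_pi_apply i)
  have hbi (i : Fin n) : IsBddFun fun p : T × (Fin n → X) => h p.1 (p.2 i) :=
    hb.comp fun p : T × (Fin n → X) => (p.1, p.2 i)
  have hmean (t : T) (i : Fin n) : ∫ x, h t (x i) ∂P = ∫ y, h t y ∂ν :=
    (integral_comp_eval (μ := fun _ : Fin n => ν) (i := i) (hm t).aestronglyMeasurable)
  -- introducing the ghost sample
  have hpair : IsBddFun fun p : T × ((Fin n → X) × (Fin n → X)) =>
      ∑ i, (h p.1 (p.2.2 i) - h p.1 (p.2.1 i)) := by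
    refine IsBddFun.sum _ fun i => ?_
    exact ((hbi i).comp fun p : T × ((Fin n → X) × (Fin n → X)) => (p.1, p.2.2)).sub
      ((hbi i).comp fun p : T × ((Fin n → X) × (Fin n → X)) => (p.1, p.2.1))
  have hpairm : Measurable fun q : (Fin n → X) × (Fin n → X) =>
      ⨆ t, ∑ i, (h t (q.2 i) - h t (q.1 i)) :=
    Measurable.iSup fun t => Finset.measurable_sum _ fun i _ =>
      ((hmi t i).comp measurable_snd).sub ((hmi t i).comp measurable_fst)
  have hpairs : IsBddFun fun q : (Fin n → X) × (Fin n → X) =>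
      ⨆ t, ∑ i, (h t (q.2 i) - h t (q.1 i)) :=
    IsBddFun.ciSup (f := fun t (q : (Fin n → X) × (Fin n → X)) =>
      ∑ i, (h t (q.2 i) - h t (q.1 i))) hpair
  have hghost (x : Fin n → X) : ⨆ t, ∑ i, (∫ y, h t y ∂ν - h t (x i)) ≤
      ∫ x', ⨆ t, ∑ i, (h t (x' i) - h t (x i)) ∂P := by
    refine ciSup_le fun t => ?_
    have hint (i : Fin n) : Integrable (fun x' : Fin n → X => h t (x' i)) P :=
      ((hbi i).comp fun x' => (t, x')).integrable (hmi t i)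
    have hint' (i : Fin n) : Integrable (fun x' : Fin n → X => h t (x' i) - h t (x i)) P :=
      (hint i).sub (integrable_const _)
    have hsum : ∑ i, (∫ y, h t y ∂ν - h t (x i)) =
        ∫ x' : Fin n → X, ∑ i, (h t (x' i) - h t (x i)) ∂P := by
      rw [integral_finsetSum _ fun i _ => hint' i]
      refine Finset.sum_congr rfl fun i _ => ?_
      rw [integral_sub (hint i) (integrable_const _), hmean]
      simp
    have hsup : Integrable (fun x' : Fin n → X => ⨆ t, ∑ i, (h t (x' i) - h t (x i))) P :=
      IsBddFun.integrable (hpairs.comp fun x' : Fin n → X => (x, x'))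
        (hpairm.comp (measurable_prodMk_left (x := x)))
    rw [hsum]
    refine integral_mono (integrable_finsetSum _ fun i _ => hint' i) hsup fun x' => ?_
    have hbt : IsBddFun fun t => ∑ i, (h t (x' i) - h t (x i)) :=
      hpair.comp fun t : T => (t, (x, x'))
    exact hbt.le_ciSup t
  have hdevb : IsBddFun fun p : T × (Fin n → X) => ∑ i, (∫ y, h p.1 y ∂ν - h p.1 (p.2 i)) :=
    IsBddFun.sum _ fun i => ((IsBddFun.integral (μ := ν) hb).comp fun p : T × (Fin n → X) => p.1).sub (hbi i)
  have hdevs : IsBddFun fun x : Fin n → X => ⨆ t, ∑ i, (∫ y, h t y ∂ν - h t (x i)) :=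
    IsBddFun.ciSup (f := fun t (x : Fin n → X) => ∑ i, (∫ y, h t y ∂ν - h t (x i))) hdevb
  have hdevm : Measurable fun x : Fin n → X => ⨆ t, ∑ i, (∫ y, h t y ∂ν - h t (x i)) :=
    Measurable.iSup fun t => Finset.measurable_sum _ fun i _ => (hmi t i).const_sub _
  have hstep1 : ∫ x : Fin n → X, ⨆ t, ∑ i, (∫ y, h t y ∂ν - h t (x i)) ∂P ≤
      ∫ z : Fin n → X × X, ⨆ t, ∑ i, (h t (z i).2 - h t (z i).1) ∂Q := by
    have hmp := measurePreserving_arrowProdEquivProdArrow X X (Fin n) (fun _ => ν) (fun _ => ν)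
    refine (integral_mono (hdevs.integrable hdevm) ?_ hghost).trans (le_of_eq ?_)
    · exact (IsBddFun.integral (f := fun x x' : Fin n → X => ⨆ t, ∑ i, (h t (x' i) - h t (x i)))
        hpairs).integrable
        hpairm.stronglyMeasurable.integral_prod_right.measurable
    · have := hmp.integral_comp' fun q : (Fin n → X) × (Fin n → X) =>
        ⨆ t, ∑ i, (h t (q.2 i) - h t (q.1 i))
      refine Eq.trans ?_ this.symm
      exact (integral_prod (μ := P) (ν := P) (fun q : (Fin n → X) × (Fin n → X) =>
        ⨆ t, ∑ i, (h t (q.2 i) - h t (q.1 i))) (hpairs.integrable hpairm)).symm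
  -- signed Rademacher sums
  set S : (Fin n → Bool) → (Fin n → X) → ℝ := fun σ x => ⨆ t, ∑ i, boolSign (σ i) * h t (x i)
    with hS
  have hSm (σ : Fin n → Bool) : Measurable (S σ) :=
    Measurable.iSup fun t => Finset.measurable_sum _ fun i _ => (hmi t i).const_mul _
  have hSb' (σ : Fin n → Bool) :
      IsBddFun fun p : T × (Fin n → X) => ∑ i, boolSign (σ i) * h p.1 (p.2 i) :=
    IsBddFun.sum _ fun i => (hbi i).const_mul _
  have hSb (σ : Fin n → Bool) : IsBddFun (S σ) := 
    IsBddFun.ciSup (f := fun t (x : Fin n → X) => ∑ i, boolSign (σ i) * h t (x i)) (hSb' σ)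
  have hmp1 : MeasurePreserving (fun (z : Fin n → X × X) i => (z i).1) Q P :=
    measurePreserving_pi _ _ fun _ => measurePreserving_fst
  have hmp2 : MeasurePreserving (fun (z : Fin n → X × X) i => (z i).2) Q P :=
    measurePreserving_pi _ _ fun _ => measurePreserving_snd
  have hint (σ : Fin n → Bool) {f : (Fin n → X × X) → Fin n → X} (hf : MeasurePreserving f Q P) :
      ∫ z, S σ (f z) ∂Q = ∫ x, S σ x ∂P := by
    rw [← hf.map_eq, integral_map hf.measurable.aemeasurable
      (hSm σ).aestronglyMeasurable]
  have hstep2 (σ : Fin n → Bool) :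
      ∫ z : Fin n → X × X, ⨆ t, ∑ i, (h t (z i).2 - h t (z i).1) ∂Q ≤
        ∫ x, S σ x ∂P + ∫ x, S (fun i => !σ i) x ∂P := by
    let e : (Fin n → X × X) → Fin n → X × X := fun z i => if σ i then z i else (z i).swap
    have he : MeasurePreserving e Q Q := by
      refine measurePreserving_pi (f := fun i (p : X × X) => if σ i then p else p.swap) _ _ fun i => ?_
      cases σ i
      · simpa using Measure.measurePreserving_swap
      · simp only [if_true]
        exact MeasurePreserving.id _
    have hDm : Measurable fun z : Fin n → X × X => ⨆ t, ∑ i, (h t (z i).2 - h t (z i).1) :=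
      hpairm.comp (g := fun q : (Fin n → X) × (Fin n → X) =>
        ⨆ t, ∑ i, (h t (q.2 i) - h t (q.1 i))) (hmp1.measurable.prodMk hmp2.measurable)
    have hDb : IsBddFun fun z : Fin n → X × X => ⨆ t, ∑ i, (h t (z i).2 - h t (z i).1) :=
      hpairs.comp fun z : Fin n → X × X => (fun i => (z i).1, fun i => (z i).2)
    have hswap : ∫ z : Fin n → X × X, ⨆ t, ∑ i, (h t (z i).2 - h t (z i).1) ∂Q =
        ∫ z, ⨆ t, ∑ i, (h t (e z i).2 - h t (e z i).1) ∂Q := by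
      conv_lhs => rw [← he.map_eq]
      rw [integral_map he.measurable.aemeasurable hDm.aestronglyMeasurable]
    rw [hswap, ← hint σ hmp2, ← hint (fun i => !σ i) hmp1, ← integral_add
      (((hSb σ).comp _).integrable ((hSm σ).comp hmp2.measurable))
      (((hSb _).comp _).integrable ((hSm _).comp hmp1.measurable))]
    refine integral_mono ((hDb.comp e).integrable (hDm.comp he.measurable))
      ((((hSb σ).comp _).integrable ((hSm σ).comp hmp2.measurable)).add
      (((hSb _).comp _).integrable ((hSm _).comp hmp1.measurable))) fun z => ?_
    refine ciSup_le fun t => ?_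
    refine le_trans (le_of_eq ?_) (add_le_add
      (((hSb' σ).comp fun t => (t, fun i => (z i).2)).le_ciSup t)
      (((hSb' fun i => !σ i).comp fun t => (t, fun i => (z i).1)).le_ciSup t))
    rw [← Finset.sum_add_distrib]
    refine Finset.sum_congr rfl fun i _ => ?_
    cases hσ : σ i <;> simp [e, hσ] <;> ring
  have hstep3 : ∫ z : Fin n → X × X, ⨆ t, ∑ i, (h t (z i).2 - h t (z i).1) ∂Q ≤
      2 * 𝔼 σ, ∫ x, S σ x ∂P := by
    have h1 := Finset.expect_le_expect fun σ (_ : σ ∈ (Finset.univ : Finset (Fin n → Bool))) =>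
      hstep2 σ
    rw [Fintype.expect_const, Finset.expect_add_distrib,
      expect_not n fun σ => ∫ x, S σ x ∂P] at h1
    linarith
  refine (hstep1.trans hstep3).trans (le_of_eq ?_)
  congr 1
  simp only [Fintype.expect_eq_sum_div_card]
  rw [integral_div, integral_finsetSum _ fun σ _ => (hSb σ).integrable (hSm σ)]

end Symmetrization

section UniformDeviation

open MeasureTheory ProbabilityTheory
open scoped BigOperators NNReal

variable {X T : Type*} [MeasurableSpace X] [Countable T] [Nonempty T] {n : ℕ}

omit [MeasurableSpace X] [Countable T] [Nonempty T] in
lemma isBddFun_rademacher_sum {h : T → X → ℝ} (hb : IsBddFun fun p : T × X => h p.1 p.2)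
    (σ : Fin n → Bool) :
    IsBddFun fun p : T × (Fin n → X) => ∑ i, boolSign (σ i) * h p.1 (p.2 i) :=
  IsBddFun.sum _ fun i => (hb.comp fun p : T × (Fin n → X) => (p.1, p.2 i)).const_mul _

lemma integrable_rademacher_average (ν : Measure X) [IsProbabilityMeasure ν] {h : T → X → ℝ}
    (hm : ∀ t, Measurable (h t)) (hb : IsBddFun fun p : T × X => h p.1 p.2) :
    Integrable (fun x : Fin n → X => 𝔼 σ : Fin n → Bool, ⨆ t, ∑ i, boolSign (σ i) * h t (x i))
      (Measure.pi fun _ => ν) := by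
  simp only [Fintype.expect_eq_sum_div_card]
  refine (integrable_finsetSum _ fun σ _ => ?_).div_const _
  refine IsBddFun.integrable (IsBddFun.ciSup (f := fun t (x : Fin n → X) =>
    ∑ i, boolSign (σ i) * h t (x i)) (isBddFun_rademacher_sum hb σ)) ?_
  exact Measurable.iSup fun t => Finset.measurable_sum _ fun i _ =>
    ((hm t).comp (measurable_pi_apply i)).const_mul _

/-- Vector contraction for expected Rademacher averages. -/
lemma integral_rademacher_contraction (ν : Measure X) [IsProbabilityMeasure ν] {K : ℕ}
    {ψ : T → X → ℝ} {v : T → X → Fin K → ℝ} {L : ℝ} (hL : 0 ≤ L)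
    (hψm : ∀ t, Measurable (ψ t)) (hψb : IsBddFun fun p : T × X => ψ p.1 p.2)
    (hvm : ∀ t k, Measurable fun x => v t x k)
    (hvb : ∀ k, IsBddFun fun p : T × X => v p.1 p.2 k)
    (hψ : ∀ x t t', |ψ t x - ψ t' x| ≤ L * √(∑ k, (v t x k - v t' x k) ^ 2)) :
    ∫ x : Fin n → X, 𝔼 σ : Fin n → Bool, ⨆ t, ∑ i, boolSign (σ i) * ψ t (x i)
        ∂(Measure.pi fun _ => ν) ≤
      √2 * L * ∑ k, ∫ x : Fin n → X, 𝔼 σ : Fin n → Bool,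
        ⨆ t, ∑ i, boolSign (σ i) * v t (x i) k ∂(Measure.pi fun _ => ν) := by
  have hvi (k : Fin K) := integrable_rademacher_average (n := n) ν (fun t => hvm t k) (hvb k)
  rw [← integral_finsetSum _ fun k _ => hvi k, ← integral_const_mul]
  refine integral_mono (integrable_rademacher_average ν hψm hψb)
    ((integrable_finsetSum _ fun k _ => hvi k).const_mul _) fun x => ?_
  exact rademacher_vector_contraction (ψ := fun i t => ψ t (x i)) (v := fun i t k => v t (x i) k)
    hL (fun i => hψb.comp fun t : T => (t, x i))
    (fun i k => (hvb k).comp fun t : T => (t, x i)) fun i t t' => hψ (x i) t t'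

omit [Countable T] in
lemma abs_ciSup_sub_ciSup_le {f g : T → ℝ} {c : ℝ} (hf : IsBddFun f) (hg : IsBddFun g)
    (h : ∀ t, |f t - g t| ≤ c) : |(⨆ t, f t) - ⨆ t, g t| ≤ c := by
  have h1 : ⨆ t, f t ≤ (⨆ t, g t) + c :=
    ciSup_le fun t => by linarith [hg.le_ciSup t, (abs_le.1 (h t)).2]
  have h2 : ⨆ t, g t ≤ (⨆ t, f t) + c :=
    ciSup_le fun t => by linarith [hf.le_ciSup t, (abs_le.1 (h t)).1]
  exact abs_le.2 ⟨by linarith, by linarith⟩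

omit [MeasurableSpace X] [Countable T] [Nonempty T] in
lemma isBddFun_deviation_sum (m : T → ℝ) (hm : IsBddFun m) {h : T → X → ℝ}
    (hb : IsBddFun fun p : T × X => h p.1 p.2) :
    IsBddFun fun p : T × (Fin n → X) => ∑ i, (m p.1 - h p.1 (p.2 i)) :=
  IsBddFun.sum _ fun i => (hm.comp fun p : T × (Fin n → X) => p.1).sub
    (hb.comp fun p : T × (Fin n → X) => (p.1, p.2 i))

omit [MeasurableSpace X] [Countable T] in
/-- The supremum of the deviations has bounded differences. -/
lemma ciSup_deviation_update_le (m : T → ℝ) (hm : IsBddFun m) {h : T → X → ℝ}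
    (hb : IsBddFun fun p : T × X => h p.1 p.2) {D : ℝ} (hD : ∀ t x y, |h t x - h t y| ≤ D)
    (x : Fin n → X) (i : Fin n) (y : X) :
    |(⨆ t, ∑ j, (m t - h t (Function.update x i y j))) - ⨆ t, ∑ j, (m t - h t (x j))| ≤ D := by
  refine abs_ciSup_sub_ciSup_le
    ((isBddFun_deviation_sum m hm hb).comp fun t : T => (t, Function.update x i y))
    ((isBddFun_deviation_sum m hm hb).comp fun t : T => (t, x)) fun t => ?_
  rw [← Finset.sum_sub_distrib, Finset.sum_eq_single i]
  · simpa using hD t (x i) y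
  · intro j _ hj
    simp [Function.update_of_ne hj]
  · simp

/-- Two-sided uniform deviation bound, in terms of a common bound `M` on the Rademacher
averages of a class with values in `[0, D]` and of its negation. -/
theorem uniform_deviation_bound (ν : Measure X) [IsProbabilityMeasure ν] {h : T → X → ℝ}
    (hm : ∀ t, Measurable (h t)) {D : ℝ} (hD : 0 ≤ D) (h0 : ∀ t x, h t x ∈ Set.Icc 0 D)
    (hn : 1 ≤ n) {M : ℝ}
    (hM : ∫ x : Fin n → X, 𝔼 σ : Fin n → Bool, ⨆ t, ∑ i, boolSign (σ i) * h t (x i)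
        ∂(Measure.pi fun _ => ν) ≤ M)
    (hM' : ∫ x : Fin n → X, 𝔼 σ : Fin n → Bool, ⨆ t, ∑ i, boolSign (σ i) * -h t (x i)
        ∂(Measure.pi fun _ => ν) ≤ M)
    {δ : ℝ} (hδ : δ ∈ Set.Ioo (0 : ℝ) 1) :
    ENNReal.ofReal (1 - δ) ≤ (Measure.pi fun _ : Fin n => ν)
      {x | ∀ t t', ∑ i, (∫ y, h t y ∂ν - h t (x i)) + ∑ i, (h t' (x i) - ∫ y, h t' y ∂ν) ≤
        4 * M + 2 * D * √(n * Real.log (2 / δ) / 2)} := by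
  set P : Measure (Fin n → X) := Measure.pi fun _ => ν with hP
  have hb : IsBddFun fun p : T × X => h p.1 p.2 :=
    ⟨D, fun p => by rw [abs_of_nonneg (h0 _ _).1]; exact (h0 _ _).2⟩
  have hb' : IsBddFun fun p : T × X => -h p.1 p.2 := by simpa using hb.const_mul (-1)
  have hd (t : T) (x y : X) : |h t x - h t y| ≤ D :=
    abs_le.2 ⟨by linarith [(h0 t x).1, (h0 t y).2], by linarith [(h0 t x).2, (h0 t y).1]⟩
  have hmean : IsBddFun fun t => ∫ y, h t y ∂ν := hb.integral
  have hmean' : IsBddFun fun t => ∫ y, -h t y ∂ν := hb'.integral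
  set Z₁ : (Fin n → X) → ℝ := fun x => ⨆ t, ∑ i, (∫ y, h t y ∂ν - h t (x i)) with hZ₁
  set Z₂ : (Fin n → X) → ℝ := fun x => ⨆ t, ∑ i, (∫ y, -h t y ∂ν - -h t (x i)) with hZ₂
  have hZ₁b : IsBddFun Z₁ := IsBddFun.ciSup
    (f := fun t (x : Fin n → X) => ∑ i, (∫ y, h t y ∂ν - h t (x i)))
    (isBddFun_deviation_sum _ hmean hb)
  have hZ₂b : IsBddFun Z₂ := IsBddFun.ciSup
    (f := fun t (x : Fin n → X) => ∑ i, (∫ y, -h t y ∂ν - -h t (x i)))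
    (isBddFun_deviation_sum (h := fun t x => -h t x) _ hmean' hb')
  have hZ₁m : Measurable Z₁ := Measurable.iSup fun t => Finset.measurable_sum _ fun i _ =>
    ((hm t).comp (measurable_pi_apply i)).const_sub _
  have hZ₂m : Measurable Z₂ := Measurable.iSup fun t => Finset.measurable_sum _ fun i _ =>
    ((hm t).neg.comp (measurable_pi_apply i)).const_sub _
  have hle (x : Fin n → X) (t t' : T) :
      ∑ i, (∫ y, h t y ∂ν - h t (x i)) + ∑ i, (h t' (x i) - ∫ y, h t' y ∂ν) ≤ Z₁ x + Z₂ x := by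
    have e1 := ((isBddFun_deviation_sum _ hmean hb).comp fun t : T => (t, x)).le_ciSup t
    have e2 := ((isBddFun_deviation_sum (h := fun t x => -h t x) _ hmean' hb').comp fun t : T => (t, x)).le_ciSup t'
    refine add_le_add e1 (le_trans (le_of_eq (Finset.sum_congr rfl fun i _ => ?_)) e2)
    rw [integral_neg]
    ring
  have hmeanZ : ∫ x, (Z₁ x + Z₂ x) ∂P ≤ 4 * M := by
    rw [integral_add (hZ₁b.integrable hZ₁m) (hZ₂b.integrable hZ₂m)]
    have e1 := integral_ciSup_deviation_le (n := n) ν hm hb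
    have e2 := integral_ciSup_deviation_le (n := n) ν (h := fun t x => -h t x)
      (fun t => (hm t).neg) hb'
    linarith
  rcases hD.eq_or_lt with rfl | hDpos
  · have hz (t : T) (x : X) : h t x = 0 := le_antisymm (h0 t x).2 (h0 t x).1
    have hM0 : 0 ≤ M := by simpa [hZ₁, hZ₂, hz] using hmeanZ
    rw [show {x : Fin n → X | _} = Set.univ from Set.eq_univ_of_forall fun x => by
      simpa [hz] using hM0, measure_univ]
    exact ENNReal.ofReal_le_one.2 (by linarith [hδ.1])
  lift D to ℝ≥0 using hD
  have hlog : 0 ≤ Real.log (2 / δ) :=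
    Real.log_nonneg (by rw [le_div_iff₀ hδ.1]; linarith [hδ.2])
  have hsub := hasSubgaussianMGF_of_bounded_differences (n := n) ν (c := 2 * D)
    (F := fun x => Z₁ x + Z₂ x) (hZ₁m.add hZ₂m) (hZ₁b.add hZ₂b) fun x i y => by
      have e1 := ciSup_deviation_update_le _ hmean hb hd x i y
      have e2 := ciSup_deviation_update_le (h := fun t x => -h t x) _ hmean' hb'
        (fun t x y => by rw [← neg_sub', abs_neg]; exact hd t x y) x i y
      push_cast
      rw [add_sub_add_comm, two_mul]
      exact (abs_add_le _ _).trans (add_le_add e1 e2)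
  set ε : ℝ := 2 * D * √(n * Real.log (2 / δ) / 2) with hε
  have hn0 : (0 : ℝ) < n := by exact_mod_cast hn
  have htail := hsub.measure_ge_le (ε := ε) (by positivity)
  have hexp : Real.exp (-ε ^ 2 / (2 * ((n * (2 * D / 2) ^ 2 : ℝ≥0) : ℝ))) = δ / 2 := by
    have : -ε ^ 2 / (2 * ((n * (2 * D / 2) ^ 2 : ℝ≥0) : ℝ)) = -Real.log (2 / δ) := by
      rw [hε, mul_pow, Real.sq_sqrt (by positivity)]
      push_cast
      field_simp
    rw [this, ← Real.log_inv, Real.exp_log (inv_pos.2 (div_pos two_pos hδ.1)), inv_div]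
  rw [hexp] at htail
  set bad : Set (Fin n → X) := {x | ε ≤ Z₁ x + Z₂ x - ∫ y, (Z₁ y + Z₂ y) ∂P} with hbad
  have hbadm : MeasurableSet bad :=
    measurableSet_le measurable_const ((hZ₁m.add hZ₂m).sub_const _)
  calc ENNReal.ofReal (1 - δ) ≤ ENNReal.ofReal (P.real badᶜ) := by
        refine ENNReal.ofReal_le_ofReal ?_
        rw [probReal_compl_eq_one_sub hbadm]
        linarith [hδ.1]
    _ = P badᶜ := ofReal_measureReal
    _ ≤ _ := by
        refine measure_mono fun x hx t t' => ?_
        simp only [hbad, Set.mem_compl_iff, Set.mem_ofPred_eq, not_le] at hx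
        linarith [hle x t t']

end UniformDeviation

section ClassConditional

open MeasureTheory
open scoped BigOperators

lemma rademacherComplexity_image {X : Type*} [MeasurableSpace X] (ν : Measure X) (n : ℕ)
    {E : Type*} (G : Set E) (e : E → X → ℝ) :
    rademacherComplexity ν n (e '' G) =
      ∫ x : Fin n → X, Finset.univ.expect fun σ : Fin n → Bool =>
        ⨆ g : G, ∑ i, boolSign (σ i) * (e g (x i) / n) ∂(Measure.pi fun _ => ν) := by
  unfold rademacherComplexity
  refine integral_congr_ae (Filter.Eventually.of_forall fun x => ?_)
  simp only [Fintype.expect_eq_sum_div_card, Set.image_image, sSup_image', Fintype.card_fun,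
    Fintype.card_bool, Fintype.card_fin, Nat.cast_pow, Nat.cast_ofNat, Finset.sum_div, mul_div_assoc,
    boolSign]

/-- A loss that is Lipschitz on a box is measurable along measurable functions into the box. -/
lemma measurable_comp_of_lipschitz_on_box {X : Type*} [MeasurableSpace X] {K : ℕ} {C L : ℝ}
    {f : EuclideanSpace ℝ (Fin K) → ℝ}
    (hf : ∀ u u' : EuclideanSpace ℝ (Fin K), (∀ y, |u y| ≤ C) → (∀ y, |u' y| ≤ C) →
      |f u - f u'| ≤ L * ‖u - u'‖)
    {g : X → EuclideanSpace ℝ (Fin K)} (hg : Measurable g) (hgC : ∀ x y, |g x y| ≤ C) :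
    Measurable fun x => f (g x) := by
  have hcont : Continuous fun u : {u : EuclideanSpace ℝ (Fin K) // ∀ y, |u y| ≤ C} => f u :=
    (LipschitzWith.of_dist_le' (K := L) fun u u' => by
      rw [Real.dist_eq, Subtype.dist_eq, dist_eq_norm]
      exact hf u u' u.2 u'.2).continuous
  exact hcont.measurable.comp (hg.subtype_mk (h := fun x => hgC x))

lemma isProbabilityMeasure_class_conditional {X : Type*} [MeasurableSpace X] (μ : Measure X)
    {f : X → ℝ} (hf0 : ∀ x, 0 ≤ f x) (hf : Integrable f μ) (hpos : 0 < ∫ x, f x ∂μ) :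
    IsProbabilityMeasure ((ENNReal.ofReal (∫ x, f x ∂μ))⁻¹ •
      μ.withDensity fun x => ENNReal.ofReal (f x)) := by
  constructor
  rw [Measure.smul_apply, withDensity_apply _ MeasurableSet.univ, Measure.restrict_univ,
    ← ofReal_integral_eq_lintegral_ofReal hf (Filter.Eventually.of_forall hf0), smul_eq_mul]
  exact ENNReal.inv_mul_cancel (ENNReal.ofReal_pos.2 hpos).ne' ENNReal.ofReal_ne_top

end ClassConditional

/-- **Excess surrogate risk bound for noise-robust SC-Conf classification (Lemma 1).**
With probability at least `1 − δ` over an i.i.d. sample of size `n` from the single-class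
conditional distribution `ν = p(x|y_s)`, every empirical risk minimizer `ĝ` of the
noise-robust empirical risk satisfies, for every `g̃* ∈ G`,
`R̃(ĝ) − R̃(g̃*) ≤ (4√2 L_ℓ / C_r) ∑_y Rad_n(G_y, ν) + (2 C_ℓ / C_r) √(log(2/δ)/(2n))`. -/
theorem norsc_conf_excess_risk_bound
    {X : Type*} [MeasurableSpace X] (μ : Measure X) [IsProbabilityMeasure μ]
    {K : ℕ} (hK : 2 ≤ K) (r : Fin K → X → ℝ)
    (hrm : ∀ y, Measurable (r y)) (hr0 : ∀ y x, 0 ≤ r y x)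
    (hr1 : ∀ x, ∑ y, r y x = 1)
    (ys : Fin K) (Cr : ℝ) (hCr : Cr ∈ Set.Ioc (0 : ℝ) 1)
    (hrC : ∀ᵐ x ∂μ, Cr ≤ r ys x)
    (π : ℝ) (hπ : π = ∫ x, r ys x ∂μ) (hπ0 : 0 < π)
    (ν : Measure X)
    (hν : ν = (ENNReal.ofReal π)⁻¹ • μ.withDensity fun x => ENNReal.ofReal (r ys x))
    (rt : Fin K → X → ℝ)
    (hrtm : ∀ y, Measurable (rt y)) (hrt0 : ∀ y x, 0 ≤ rt y x)
    (hrt1 : ∀ x, ∑ y, rt y x = 1)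
    (G : Set (X → EuclideanSpace ℝ (Fin K))) (hGc : G.Countable) (hGne : G.Nonempty)
    (hGm : ∀ g ∈ G, Measurable g)
    (Cg : ℝ) (hGb : ∀ g ∈ G, ∀ x, ∀ y, |g x y| ≤ Cg)
    (ℓ : EuclideanSpace ℝ (Fin K) → Fin K → ℝ) (Cℓ Lℓ : ℝ)
    (hℓb : ∀ u : EuclideanSpace ℝ (Fin K), (∀ y, |u y| ≤ Cg) →
      ∀ y, 0 ≤ ℓ u y ∧ ℓ u y ≤ Cℓ)
    (hℓL : ∀ u u' : EuclideanSpace ℝ (Fin K), (∀ y, |u y| ≤ Cg) → (∀ y, |u' y| ≤ Cg) →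
      ∀ y, |ℓ u y - ℓ u' y| ≤ Lℓ * ‖u - u'‖)
    (n : ℕ) (hn : 1 ≤ n) (δ : ℝ) (hδ : δ ∈ Set.Ioo (0 : ℝ) 1) :
    ENNReal.ofReal (1 - δ) ≤
      (Measure.pi fun _ : Fin n => ν)
        {xs | ∀ ghat ∈ G,
          (∀ g ∈ G,
              (1 / n : ℝ) * ∑ i, (π / r ys (xs i)) * ∑ y, rt y (xs i) * ℓ (ghat (xs i)) y ≤
                (1 / n : ℝ) * ∑ i, (π / r ys (xs i)) * ∑ y, rt y (xs i) * ℓ (g (xs i)) y) →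
          ∀ gstar ∈ G,
            (∫ x, (π / r ys x) * ∑ y, rt y x * ℓ (ghat x) y ∂ν) -
                ∫ x, (π / r ys x) * ∑ y, rt y x * ℓ (gstar x) y ∂ν ≤
              4 * Real.sqrt 2 * Lℓ / Cr *
                  ∑ y, rademacherComplexity ν n ((fun g x => g x y) '' G) +
                2 * Cℓ / Cr * Real.sqrt (Real.log (2 / δ) / (2 * n))} := by
  obtain ⟨hCr0, hCr1⟩ := hCr
  have hrle (x : X) : r ys x ≤ 1 :=
    (Finset.single_le_sum (fun y _ => hr0 y x) (Finset.mem_univ ys)).trans_eq (hr1 x)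
  have hrint : Integrable (r ys) μ := Integrable.of_bound (hrm ys).aestronglyMeasurable 1
    (Filter.Eventually.of_forall fun x => by
      rw [Real.norm_of_nonneg (hr0 ys x)]; exact hrle x)
  have hπ1 : π ≤ 1 := by
    rw [hπ]
    simpa using integral_mono hrint (integrable_const (1 : ℝ)) hrle
  have hνprob : IsProbabilityMeasure ν := by
    rw [hν, hπ]
    exact isProbabilityMeasure_class_conditional μ (hr0 ys) hrint (hπ ▸ hπ0)
  have hνμ : ν ≪ μ := by
    rw [hν]
    exact (withDensity_absolutelyContinuous _ _).smul_left _
  -- the density ratio, truncated so that its bound holds everywhere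
  set φ : X → ℝ := fun x => min (π / r ys x) (1 / Cr) with hφ
  have hφ0 (x : X) : 0 ≤ φ x := le_min (div_nonneg hπ0.le (hr0 ys x)) (by positivity)
  have hφ1 (x : X) : φ x ≤ 1 / Cr := min_le_right _ _
  have hφm : Measurable φ := ((hrm ys).const_div π).min measurable_const
  have hφae : ∀ᵐ x ∂ν, π / r ys x = φ x := by
    filter_upwards [hνμ.ae_le hrC] with x hx
    exact (min_eq_left (div_le_div₀ zero_le_one hπ1 hCr0 hx)).symm
  have hn0 : (0 : ℝ) < n := by exact_mod_cast hn
  have : Countable G := hGc.to_subtype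
  have : Nonempty G := hGne.to_subtype
  have : Nonempty X := nonempty_of_isProbabilityMeasure μ
  obtain ⟨g₀, hg₀⟩ := hGne
  let x₀ : X := Classical.arbitrary X
  have hCg : 0 ≤ Cg := (abs_nonneg _).trans (hGb g₀ hg₀ x₀ ys)
  have hCℓ : 0 ≤ Cℓ :=
    have h := hℓb (g₀ x₀) (hGb g₀ hg₀ x₀) ys
    h.1.trans h.2
  set w : G → X → ℝ := fun g x => ∑ y, rt y x * ℓ (g.1 x) y with hw
  have hwm (g : G) : Measurable (w g) := Finset.measurable_sum _ fun y _ =>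
    (hrtm y).mul (measurable_comp_of_lipschitz_on_box (f := fun u => ℓ u y)
      (fun u u' hu hu' => hℓL u u' hu hu' y) (hGm g g.2) (hGb g g.2))
  have hw0 (g : G) (x : X) : 0 ≤ w g x := Finset.sum_nonneg fun y _ =>
    mul_nonneg (hrt0 y x) (hℓb _ (hGb g g.2 x) y).1
  have hw1 (g : G) (x : X) : w g x ≤ Cℓ := by
    calc w g x ≤ ∑ y, rt y x * Cℓ := Finset.sum_le_sum fun y _ =>
          mul_le_mul_of_nonneg_left (hℓb _ (hGb g g.2 x) y).2 (hrt0 y x)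
      _ = Cℓ := by rw [← Finset.sum_mul, hrt1, one_mul]
  have hwL (g g' : G) (x : X) : |w g x - w g' x| ≤ max Lℓ 0 * ‖g.1 x - g'.1 x‖ := by
    calc |w g x - w g' x| = |∑ y, rt y x * (ℓ (g.1 x) y - ℓ (g'.1 x) y)| := by
          simp only [hw, ← Finset.sum_sub_distrib, mul_sub]
      _ ≤ ∑ y, rt y x * (max Lℓ 0 * ‖g.1 x - g'.1 x‖) := by
          refine (Finset.abs_sum_le_sum_abs _ _).trans (Finset.sum_le_sum fun y _ => ?_)
          rw [abs_mul, abs_of_nonneg (hrt0 y x)]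
          refine mul_le_mul_of_nonneg_left ?_ (hrt0 y x)
          exact (hℓL _ _ (hGb g g.2 x) (hGb g' g'.2 x) y).trans
            (mul_le_mul_of_nonneg_right (le_max_left _ _) (norm_nonneg _))
      _ = _ := by rw [← Finset.sum_mul, hrt1, one_mul]
  set h : G → X → ℝ := fun g x => φ x * w g x / n with hh
  have hhm (g : G) : Measurable (h g) := (hφm.mul (hwm g)).div_const _
  have hhI (g : G) (x : X) : h g x ∈ Set.Icc 0 (1 / Cr * Cℓ / n) :=
    ⟨div_nonneg (mul_nonneg (hφ0 x) (hw0 g x)) hn0.le, div_le_div_of_nonneg_right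
      (mul_le_mul (hφ1 x) (hw1 g x) (hw0 g x) (by positivity)) hn0.le⟩
  have hhb : IsBddFun fun p : G × X => h p.1 p.2 :=
    ⟨_, fun p => by rw [abs_of_nonneg (hhI _ _).1]; exact (hhI _ _).2⟩
  have hhL (x : X) (g g' : G) : |h g x - h g' x| ≤
      max Lℓ 0 / Cr * √(∑ k, (g.1 x k / n - g'.1 x k / n) ^ 2) := by
    have hnorm : √(∑ k, (g.1 x k / n - g'.1 x k / n) ^ 2) = ‖g.1 x - g'.1 x‖ / n := by
      rw [EuclideanSpace.norm_eq, ← Real.sqrt_sq hn0.le, ← Real.sqrt_div' _ (sq_nonneg _),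
        Finset.sum_div, Real.sqrt_sq hn0.le]
      simp only [← sub_div, div_pow, PiLp.sub_apply, Real.norm_eq_abs, sq_abs]
    rw [hnorm]
    calc |h g x - h g' x| = φ x * |w g x - w g' x| / n := by
          simp only [hh]
          rw [← sub_div, ← mul_sub, abs_div, abs_mul, abs_of_nonneg (hφ0 x), abs_of_pos hn0]
      _ ≤ 1 / Cr * (max Lℓ 0 * ‖g.1 x - g'.1 x‖) / n :=
          div_le_div_of_nonneg_right (mul_le_mul (hφ1 x) (hwL g g' x) (abs_nonneg _)
            (by positivity)) hn0.le
      _ = _ := by ring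
  set ρ : ℝ := ∑ y, rademacherComplexity ν n ((fun g x => g x y) '' G) with hρ
  have hρeq : ρ = ∑ k, ∫ x : Fin n → X, Finset.univ.expect fun σ : Fin n → Bool =>
      ⨆ g : G, ∑ i, boolSign (σ i) * (g.1 (x i) k / n) ∂(Measure.pi fun _ => ν) :=
    Finset.sum_congr rfl fun k _ => rademacherComplexity_image ν n G fun g x => g x k
  have hvm (g : G) (k : Fin K) : Measurable fun x => g.1 x k / n :=
    ((EuclideanSpace.proj (𝕜 := ℝ) k).continuous.measurable.comp (hGm g g.2)).div_const _
  have hvb (k : Fin K) : IsBddFun fun p : G × X => p.1.1 p.2 k / n :=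
    ⟨Cg / n, fun p => by
      rw [abs_div, abs_of_pos hn0]
      exact div_le_div_of_nonneg_right (hGb p.1 p.1.2 p.2 k) hn0.le⟩
  have hL0 : 0 ≤ max Lℓ 0 / Cr := div_nonneg (le_max_right _ _) hCr0.le
  have hLρ : max Lℓ 0 * ρ = Lℓ * ρ := by
    rcases le_total 0 Lℓ with hL | hL
    · rw [max_eq_left hL]
    rcases hL.eq_or_lt with rfl | hL
    · simp
    have hzero (g : G) (x : X) (k : Fin K) : g.1 x k = 0 := by
      have h1 := (abs_nonneg _).trans
        (hℓL (g.1 x) 0 (hGb g g.2 x) (fun y => by simpa using hCg) ys)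
      have h2 : ‖g.1 x‖ = 0 := le_antisymm (by
        rw [sub_zero] at h1
        exact nonpos_of_mul_nonneg_right h1 hL) (norm_nonneg _)
      simp [norm_eq_zero.1 h2]
    have : ρ = 0 := by simp [hρeq, hzero]
    simp [this]
  have hM := integral_rademacher_contraction (n := n) ν (ψ := h)
    (v := fun g x k => g.1 x k / n) hL0 hhm hhb hvm hvb hhL
  have hM' := integral_rademacher_contraction (n := n) ν (ψ := fun g x => -h g x)
    (v := fun g x k => g.1 x k / n) hL0 (fun g => (hhm g).neg)
    (by simpa using hhb.const_mul (-1)) hvm hvb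
    (fun x g g' => by rw [← neg_sub', abs_neg]; exact hhL x g g')
  rw [← hρeq] at hM hM'
  refine (uniform_deviation_bound ν hhm (by positivity) hhI hn hM hM' hδ).trans
    (measure_mono_ae ?_)
  have hsample : ∀ᵐ x : Fin n → X ∂(Measure.pi fun _ => ν), ∀ i, π / r ys (x i) = φ (x i) :=
    Filter.eventually_all.2 fun i =>
      (Measure.tendsto_eval_ae_ae (μ := fun _ : Fin n => ν) (i := i)).eventually hφae
  filter_upwards [hsample] with x hx hdev ghat hghat hERM gstar hgstar
  have hemp (g : X → EuclideanSpace ℝ (Fin K)) (hg : g ∈ G) :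
      (1 / n : ℝ) * ∑ i, (π / r ys (x i)) * ∑ y, rt y (x i) * ℓ (g (x i)) y =
        ∑ i, h ⟨g, hg⟩ (x i) := by
    rw [Finset.mul_sum]
    refine Finset.sum_congr rfl fun i _ => ?_
    rw [hx i]
    simp only [hh, hw]
    ring
  have hrisk (g : X → EuclideanSpace ℝ (Fin K)) (hg : g ∈ G) :
      ∫ x, (π / r ys x) * ∑ y, rt y x * ℓ (g x) y ∂ν = n * ∫ x, h ⟨g, hg⟩ x ∂ν := by
    rw [← integral_const_mul]
    refine integral_congr_ae ?_
    filter_upwards [hφae] with x hx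
    rw [hx]
    simp only [hh, hw]
    field_simp
  have herm := hERM gstar hgstar
  rw [hemp ghat hghat, hemp gstar hgstar] at herm
  rw [hrisk ghat hghat, hrisk gstar hgstar]
  have hdev' := hdev ⟨ghat, hghat⟩ ⟨gstar, hgstar⟩
  simp only [Finset.sum_sub_distrib, Finset.sum_const, Finset.card_univ, Fintype.card_fin,
    nsmul_eq_mul] at hdev'
  have hsqrt : √(n * Real.log (2 / δ) / 2) = n * √(Real.log (2 / δ) / (2 * n)) := by
    have : n * Real.log (2 / δ) / 2 = (n : ℝ) ^ 2 * (Real.log (2 / δ) / (2 * n)) := by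
      field_simp
    rw [this, Real.sqrt_mul (sq_nonneg _), Real.sqrt_sq hn0.le]
  have hconf : 2 * (1 / Cr * Cℓ / n) * √(n * Real.log (2 / δ) / 2) =
      2 * Cℓ / Cr * √(Real.log (2 / δ) / (2 * n)) := by
    rw [hsqrt]
    field_simp
  have hcompl : 4 * (√2 * (max Lℓ 0 / Cr) * ρ) = 4 * √2 * Lℓ / Cr * ρ := by
    calc _ = 4 * √2 / Cr * (max Lℓ 0 * ρ) := by ring
      _ = _ := by rw [hLρ]; ring
  rw [hconf, hcompl] at hdev'
  linarith
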